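/- For every integer n ≥ 1, the double integrals I₂(n) = (-1)ⁿ·∬_{[0,1]²} x^{n-1/2}(1-x)^{n-1/2} y^{n-1/2}(1-y)^{n-1/2}/(1-xy)^{n+1/2} dx dy satisfy the three-term recurrence (2n+1)²·I₂(n+1) = (44n² + 1)·I₂(n) + (2n-1)²·I₂(n-1). -/

import Mathlib

open MeasureTheory

/-- The Euler–Beukers type double integral
`I₂(n) = (-1)ⁿ ∬_{[0,1]²} (x(1-x)y(1-y))^{n-1/2} (1-xy)^{-(n+1/2)} dx dy`. -/
noncomputable def I₂ (n : ℕ) : ℝ :=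
  (-1 : ℝ) ^ n *
    ∫ p in Set.Ioo (0 : ℝ) 1 ×ˢ Set.Ioo (0 : ℝ) 1,
      p.1 ^ ((n : ℝ) - 1 / 2) * (1 - p.1) ^ ((n : ℝ) - 1 / 2) *
        p.2 ^ ((n : ℝ) - 1 / 2) * (1 - p.2) ^ ((n : ℝ) - 1 / 2) /
        (1 - p.1 * p.2) ^ ((n : ℝ) + 1 / 2)

/-- The `k`-th term of the series obtained by expanding `(1-xy)^{-c}` in the integral
`∬ (x(1-x)y(1-y))^{c-1} (1-xy)^{-c} dx dy`. -/
noncomputable def eulerTerm (c : ℝ) (k : ℕ) : ℝ :=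
  Real.Gamma c * Real.Gamma (c + k) ^ 3 / (k.factorial * Real.Gamma (2 * c + k) ^ 2)

theorem eulerTerm_pos {c : ℝ} (hc : 0 < c) (k : ℕ) : 0 < eulerTerm c k := by
  have := Real.Gamma_pos_of_pos hc
  have : 0 < Real.Gamma (c + k) := Real.Gamma_pos_of_pos (by positivity)
  have : 0 < Real.Gamma (2 * c + k) := Real.Gamma_pos_of_pos (by positivity)
  unfold eulerTerm
  positivity

theorem eulerTerm_succ {c : ℝ} (hc : 0 < c) (k : ℕ) :
    eulerTerm c (k + 1) = (c + k) ^ 3 / ((k + 1) * (2 * c + k) ^ 2) * eulerTerm c k := by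
  have h : 0 < Real.Gamma (2 * c + k) := Real.Gamma_pos_of_pos (by positivity)
  have h1 := Real.Gamma_add_one (s := c + k) (by positivity)
  have h2 := Real.Gamma_add_one (s := 2 * c + k) (by positivity)
  simp only [eulerTerm, Nat.factorial_succ, Nat.cast_mul, Nat.cast_succ, ← add_assoc, h1, h2]
  field_simp

theorem eulerTerm_add_one {c : ℝ} (hc : 0 < c) (k : ℕ) :
    eulerTerm (c + 1) k
      = c * (c + k) ^ 3 / ((2 * c + k) * (2 * c + k + 1)) ^ 2 * eulerTerm c k := by
  have h : 0 < Real.Gamma (2 * c + k) := Real.Gamma_pos_of_pos (by positivity)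
  have h0 := Real.Gamma_add_one (s := c) (by positivity)
  have h1 := Real.Gamma_add_one (s := c + k) (by positivity)
  have h2 := Real.Gamma_add_one (s := 2 * c + k) (by positivity)
  have h3 := Real.Gamma_add_one (s := 2 * c + k + 1) (by positivity)
  have e1 : c + 1 + k = c + k + 1 := by ring
  have e2 : 2 * (c + 1) + k = 2 * c + k + 1 + 1 := by ring
  simp only [eulerTerm, e1, e2, h0, h1, h2, h3]
  field_simp

/-- The numerator of the rational certificate found by Zeilberger's algorithm. -/
noncomputable def certNum (s k : ℝ) : ℝ :=
  s * k ^ 6 + (4 * s ^ 2 + 3 * s) * k ^ 5 + (-13 * s ^ 3 - 13 * s ^ 2 - 4 * s) * k ^ 4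
    + (-102 * s ^ 4 - 176 * s ^ 3 - 100 * s ^ 2 - 19 * s) * k ^ 3
    + (-225 * s ^ 5 - 516 * s ^ 4 - 419 * s ^ 3 - 141 * s ^ 2 - 16 * s) * k ^ 2
    + (-217 * s ^ 6 - 607 * s ^ 5 - 619 * s ^ 4 - 273 * s ^ 3 - 44 * s ^ 2) * k
    + (-79 * s ^ 7 - 257 * s ^ 6 - 309 * s ^ 5 - 163 * s ^ 4 - 32 * s ^ 3)

/-- The certificate, whose forward difference in `k` is the recurrence in `s` applied to
`eulerTerm s k`. -/
noncomputable def cert (s : ℝ) (k : ℕ) : ℝ :=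
  certNum s k / ((2 * s + k) * (2 * s + k + 1) * (2 * s + k + 2)) ^ 2 * (k * eulerTerm s k)

theorem eulerTerm_telescoping {s : ℝ} (hs : 0 < s) (k : ℕ) :
    (s + 1) ^ 2 * eulerTerm (s + 2) k + (11 * s ^ 2 + 11 * s + 3) * eulerTerm (s + 1) k
      - s ^ 2 * eulerTerm s k = cert s (k + 1) - cert s k := by
  have e : s + 2 = s + 1 + 1 := by ring
  rw [e, eulerTerm_add_one (by positivity), eulerTerm_add_one hs, cert, cert, eulerTerm_succ hs]
  have h0 : 2 * s + k ≠ 0 := by positivity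
  have h1 : 2 * s + k + 1 ≠ 0 := by positivity
  have h2 : 2 * s + k + 2 ≠ 0 := by positivity
  have h3 : 2 * s + k + 3 ≠ 0 := by positivity
  have e1 : 2 * (s + 1) + k = 2 * s + k + 2 := by ring
  have e2 : 2 * s + k + 2 + 1 = 2 * s + k + 3 := by ring
  have e3 : 2 * s + (k + 1 : ℝ) = 2 * s + k + 1 := by ring
  have e4 : 2 * s + k + 1 + 1 = 2 * s + k + 2 := by ring
  have e5 : 2 * s + k + 1 + 2 = 2 * s + k + 3 := by ring
  push_cast
  simp only [e1, e2, e3, e4, e5]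
  unfold certNum
  field_simp
  ring

theorem mul_eulerTerm_le_sub {c : ℝ} (hc : 0 < c) {k : ℕ} (hk : c ≤ k) :
    c / 9 * eulerTerm c k ≤ k * eulerTerm c k - (k + 1 : ℕ) * eulerTerm c (k + 1) := by
  rw [eulerTerm_succ hc]
  have hpos := eulerTerm_pos hc k
  have hk0 : (0 : ℝ) < k := hc.trans_le hk
  have e : k * eulerTerm c k -
      (k + 1 : ℕ) * ((c + k) ^ 3 / ((k + 1) * (2 * c + k) ^ 2) * eulerTerm c k) =
      (c * (k ^ 2 + c * k - c ^ 2) / (2 * c + k) ^ 2) * eulerTerm c k := by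
    push_cast; field_simp; ring
  rw [e]
  refine mul_le_mul_of_nonneg_right ?_ hpos.le
  rw [div_le_div_iff₀ (by norm_num) (by positivity)]
  have : (2 * c + k) ^ 2 ≤ 9 * (k ^ 2 + c * k - c ^ 2) := by nlinarith
  nlinarith

theorem summable_eulerTerm {c : ℝ} (hc : 0 < c) : Summable (eulerTerm c) := by
  obtain ⟨K, hK⟩ := exists_nat_ge c
  rw [← summable_nat_add_iff K]
  have h (j : ℕ) : c ≤ (j + K : ℕ) := by push_cast; linarith [Nat.cast_nonneg (α := ℝ) j]
  refine summable_of_sum_range_le (c := 9 / c * (K * eulerTerm c K))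
    (fun j ↦ (eulerTerm_pos hc _).le) fun m ↦ ?_
  have : ∑ j ∈ Finset.range m, c / 9 * eulerTerm c (j + K) ≤
      ∑ j ∈ Finset.range m,
        ((j + K : ℕ) * eulerTerm c (j + K) - (j + 1 + K : ℕ) * eulerTerm c (j + 1 + K)) := by
    refine Finset.sum_le_sum fun j _ ↦ ?_
    have := mul_eulerTerm_le_sub hc (h j)
    rwa [add_right_comm] at this
  rw [Finset.sum_range_sub' (fun j ↦ ((j + K : ℕ) : ℝ) * eulerTerm c (j + K)),
    ← Finset.mul_sum] at this
  have h2 : 0 ≤ ((m + K : ℕ) : ℝ) * eulerTerm c (m + K) :=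
    mul_nonneg (by positivity) (eulerTerm_pos hc _).le
  rw [div_mul_eq_mul_div, le_div_iff₀ hc]
  simp only [zero_add] at this
  linarith

theorem tendsto_mul_eulerTerm {c : ℝ} (hc : 0 < c) :
    Filter.Tendsto (fun k : ℕ ↦ k * eulerTerm c k) Filter.atTop (nhds 0) := by
  obtain ⟨K, hK⟩ := exists_nat_ge c
  have h (j : ℕ) : c ≤ (j + K : ℕ) := by push_cast; linarith [Nat.cast_nonneg (α := ℝ) j]
  have anti : Antitone fun j : ℕ ↦ ((j + K : ℕ) : ℝ) * eulerTerm c (j + K) := by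
    refine antitone_nat_of_succ_le fun j ↦ ?_
    have := mul_eulerTerm_le_sub hc (h j)
    have := mul_pos hc (eulerTerm_pos hc (j + K))
    rw [add_right_comm]
    linarith
  have hb : BddBelow (Set.range fun j : ℕ ↦ ((j + K : ℕ) : ℝ) * eulerTerm c (j + K)) :=
    ⟨0, by rintro _ ⟨j, rfl⟩; exact mul_nonneg (by positivity) (eulerTerm_pos hc _).le⟩
  have hlim := tendsto_atTop_ciInf anti hb
  set l := ⨅ j : ℕ, ((j + K : ℕ) : ℝ) * eulerTerm c (j + K)
  have hle (j : ℕ) : l ≤ ((j + K : ℕ) : ℝ) * eulerTerm c (j + K) := ciInf_le hb j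
  have h0 : 0 ≤ l := le_ciInf fun j ↦ mul_nonneg (by positivity) (eulerTerm_pos hc _).le
  have : l = 0 := by
    by_contra hne
    have hpos : 0 < l := lt_of_le_of_ne h0 (Ne.symm hne)
    refine Real.not_summable_one_div_natCast ?_
    rw [← summable_nat_add_iff K]
    refine Summable.of_nonneg_of_le (fun j ↦ by positivity) (fun j ↦ ?_)
      (((summable_nat_add_iff K).2 (summable_eulerTerm hc)).mul_left l⁻¹)
    have := h j
    rw [inv_mul_eq_div, div_le_div_iff₀ (by linarith) hpos, one_mul, mul_comm]
    exact hle j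
  rw [this] at hlim
  exact (Filter.tendsto_add_atTop_iff_nat K).1 hlim

theorem tendsto_certNum_div (s : ℝ) :
    Filter.Tendsto
      (fun k : ℕ ↦ certNum s k / ((2 * s + k) * (2 * s + k + 1) * (2 * s + k + 2)) ^ 2)
      Filter.atTop (nhds s) := by
  let g (u : ℝ) : ℝ :=
    (s + (4 * s ^ 2 + 3 * s) * u + (-13 * s ^ 3 - 13 * s ^ 2 - 4 * s) * u ^ 2
      + (-102 * s ^ 4 - 176 * s ^ 3 - 100 * s ^ 2 - 19 * s) * u ^ 3
      + (-225 * s ^ 5 - 516 * s ^ 4 - 419 * s ^ 3 - 141 * s ^ 2 - 16 * s) * u ^ 4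
      + (-217 * s ^ 6 - 607 * s ^ 5 - 619 * s ^ 4 - 273 * s ^ 3 - 44 * s ^ 2) * u ^ 5
      + (-79 * s ^ 7 - 257 * s ^ 6 - 309 * s ^ 5 - 163 * s ^ 4 - 32 * s ^ 3) * u ^ 6)
      / ((2 * s * u + 1) * (2 * s * u + 1 + u) * (2 * s * u + 1 + 2 * u)) ^ 2
  have hg : ContinuousAt g 0 := by
    refine ContinuousAt.div (by fun_prop) (by fun_prop) (by simp)
  have h := hg.tendsto.comp (tendsto_inv_atTop_nhds_zero_nat (𝕜 := ℝ))
  have h0 : g 0 = s := by simp [g]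
  rw [h0] at h
  refine h.congr' ?_
  filter_upwards [Filter.eventually_ne_atTop 0] with k hk
  have hk : (k : ℝ) ≠ 0 := by exact_mod_cast hk
  simp only [Function.comp, g]
  rw [← mul_div_mul_right _ _ (pow_ne_zero 6 hk)]
  congr 1
  · unfold certNum
    field_simp
  · field_simp

theorem tsum_eulerTerm_recurrence {s : ℝ} (hs : 0 < s) :
    (s + 1) ^ 2 * (∑' k, eulerTerm (s + 2) k)
      + (11 * s ^ 2 + 11 * s + 3) * (∑' k, eulerTerm (s + 1) k)
      - s ^ 2 * (∑' k, eulerTerm s k) = 0 := by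
  have h0 := (summable_eulerTerm hs).hasSum
  have h1 := (summable_eulerTerm (by positivity : 0 < s + 1)).hasSum
  have h2 := (summable_eulerTerm (by positivity : 0 < s + 2)).hasSum
  have h := ((h2.mul_left ((s + 1) ^ 2)).add (h1.mul_left (11 * s ^ 2 + 11 * s + 3))).sub
    (h0.mul_left (s ^ 2))
  refine tendsto_nhds_unique h.tendsto_sum_nat ?_
  simp only [eulerTerm_telescoping hs, Finset.sum_range_sub (cert s)]
  simpa [cert] using (tendsto_certNum_div s).mul (tendsto_mul_eulerTerm hs)

theorem choose_eq_Gamma_div {c : ℝ} (hc : 0 < c) (k : ℕ) :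
    Ring.choose (c + k - 1) k = Real.Gamma (c + k) / (Real.Gamma c * k.factorial) := by
  have hΓ := (Real.Gamma_pos_of_pos hc).ne'
  have h : (ascPochhammer ℝ k).eval c = Real.Gamma (c + k) / Real.Gamma c := by
    induction k with
    | zero => simp [hΓ]
    | succ k ih =>
      have := Real.Gamma_add_one (s := c + k) (by positivity)
      rw [ascPochhammer_succ_eval, ih, Nat.cast_succ, ← add_assoc, this]
      ring
  have h2 := Ring.factorial_nsmul_multichoose_eq_ascPochhammer c k
  rw [← Polynomial.ascPochhammer_smeval_cast ℝ, ← Polynomial.eval_eq_smeval, h, nsmul_eq_mul,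
    Ring.multichoose_eq] at h2
  rw [← div_div, ← h2, mul_div_cancel_left₀ _ (by positivity)]

theorem hasSum_one_div_one_sub_rpow {c z : ℝ} (hc : 0 < c) (h0 : 0 < z) (h1 : z < 1) :
    HasSum (fun k : ℕ ↦ Real.Gamma (c + k) / (Real.Gamma c * k.factorial) * z ^ k)
      (1 / (1 - z) ^ c) := by
  have h := (Real.one_div_one_sub_rpow_hasFPowerSeriesOnBall_zero c).hasSum (y := z)
    (by simpa [enorm_eq_nnnorm, ← NNReal.coe_lt_coe, abs_of_pos h0] using h1)
  simpa [FormalMultilinearSeries.ofScalars_apply_eq, choose_eq_Gamma_div hc, mul_comm] using h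

theorem integrableOn_and_integral_eq_beta {a b : ℝ} (ha : 0 < a) (hb : 0 < b) :
    IntegrableOn (fun x : ℝ ↦ x ^ (a - 1) * (1 - x) ^ (b - 1)) (Set.Ioo 0 1) ∧
    ∫ x in Set.Ioo (0 : ℝ) 1, x ^ (a - 1) * (1 - x) ^ (b - 1) = ProbabilityTheory.beta a b := by
  have key : Set.EqOn (fun x : ℝ ↦ (x : ℂ) ^ ((a : ℂ) - 1) * (1 - (x : ℂ)) ^ ((b : ℂ) - 1))
      (fun x : ℝ ↦ ((x ^ (a - 1) * (1 - x) ^ (b - 1) : ℝ) : ℂ)) (Set.Ioo 0 1) := by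
    intro x hx
    have h1 : 0 ≤ 1 - x := by linarith [hx.2]
    simp [Complex.ofReal_cpow hx.1.le, Complex.ofReal_cpow h1]
  constructor
  · have h := Complex.betaIntegral_convergent (u := a) (v := b) (by simpa) (by simpa)
    rw [intervalIntegrable_iff_integrableOn_Ioo_of_le zero_le_one,
      integrableOn_congr_fun key measurableSet_Ioo] at h
    simpa [IntegrableOn] using h.re
  · rw [ProbabilityTheory.beta_eq_betaIntegralReal a b ha hb, Complex.betaIntegral,
      intervalIntegral.integral_of_le zero_le_one, integral_Ioc_eq_integral_Ioo,
      setIntegral_congr_fun measurableSet_Ioo key, integral_complex_ofReal, Complex.ofReal_re]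

theorem hasSum_eulerTerm_integral {c : ℝ} (hc : 0 < c) :
    HasSum (eulerTerm c) (∫ p in Set.Ioo (0 : ℝ) 1 ×ˢ Set.Ioo (0 : ℝ) 1,
      p.1 ^ (c - 1) * (1 - p.1) ^ (c - 1) * p.2 ^ (c - 1) * (1 - p.2) ^ (c - 1) /
        (1 - p.1 * p.2) ^ c) := by
  let a (k : ℕ) : ℝ := Real.Gamma (c + k) / (Real.Gamma c * k.factorial)
  let f (k : ℕ) (x : ℝ) : ℝ := x ^ (c + k - 1) * (1 - x) ^ (c - 1)
  let F (k : ℕ) (p : ℝ × ℝ) : ℝ := a k * (f k p.1 * f k p.2)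
  have hΓ := Real.Gamma_pos_of_pos hc
  have hf (k : ℕ) := integrableOn_and_integral_eq_beta (a := c + k) (by positivity) hc
  have hvol : (volume : Measure (ℝ × ℝ)).restrict (Set.Ioo (0 : ℝ) 1 ×ˢ Set.Ioo (0 : ℝ) 1)
      = (volume.restrict (Set.Ioo (0 : ℝ) 1)).prod (volume.restrict (Set.Ioo (0 : ℝ) 1)) := by
    rw [Measure.prod_restrict, Measure.volume_eq_prod]
  have hS : MeasurableSet (Set.Ioo (0 : ℝ) 1 ×ˢ Set.Ioo (0 : ℝ) 1) :=
    measurableSet_Ioo.prod measurableSet_Ioo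
  have hF (k : ℕ) :
      Integrable (F k) (volume.restrict (Set.Ioo (0 : ℝ) 1 ×ˢ Set.Ioo (0 : ℝ) 1)) := by
    rw [hvol]
    exact ((hf k).1.integrable.mul_prod (hf k).1.integrable).const_mul (a k)
  have hval (k : ℕ) : ∫ p in Set.Ioo (0 : ℝ) 1 ×ˢ Set.Ioo (0 : ℝ) 1, F k p = eulerTerm c k := by
    rw [hvol, integral_const_mul (a k), integral_prod_mul (f k) (f k), (hf k).2]
    have : 0 < Real.Gamma (2 * c + k) := Real.Gamma_pos_of_pos (by positivity)
    have e : c + k + c = 2 * c + k := by ring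
    simp only [ProbabilityTheory.beta, a, e, eulerTerm]
    field_simp
  have hnorm (k : ℕ) :
      ∫ p in Set.Ioo (0 : ℝ) 1 ×ˢ Set.Ioo (0 : ℝ) 1, ‖F k p‖ = eulerTerm c k := by
    rw [← hval k]
    refine setIntegral_congr_fun hS fun p hp ↦ Real.norm_of_nonneg ?_
    obtain ⟨⟨h1, h2⟩, h3, h4⟩ := hp
    have : 0 < Real.Gamma (c + k) := Real.Gamma_pos_of_pos (by positivity)
    have : 0 < 1 - p.1 := by linarith
    have : 0 < 1 - p.2 := by linarith
    simp only [F, f, a]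
    positivity
  have h := hasSum_integral_of_summable_integral_norm hF
    (by simpa only [hnorm] using summable_eulerTerm hc)
  simp only [hval] at h
  rw [setIntegral_congr_fun hS (g := fun p ↦ ∑' k, F k p) fun p hp ↦ ?_]
  · exact h
  obtain ⟨⟨h1, h2⟩, h3, h4⟩ := hp
  have hs := (hasSum_one_div_one_sub_rpow hc (mul_pos h1 h3) (by nlinarith)).mul_left
    (p.1 ^ (c - 1) * (1 - p.1) ^ (c - 1) * p.2 ^ (c - 1) * (1 - p.2) ^ (c - 1))
  rw [mul_one_div] at hs
  rw [← hs.tsum_eq]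
  refine tsum_congr fun k ↦ ?_
  have e : c + k - 1 = c - 1 + k := by ring
  simp only [F, f, a, e, Real.rpow_add_natCast h1.ne', Real.rpow_add_natCast h3.ne', mul_pow]
  ring

theorem I₂_eq (n : ℕ) : I₂ n = (-1) ^ n * ∑' k, eulerTerm (n + 1 / 2) k := by
  rw [(hasSum_eulerTerm_integral (by positivity : (0 : ℝ) < n + 1 / 2)).tsum_eq, I₂]
  have e : (n : ℝ) + 1 / 2 - 1 = n - 1 / 2 := by ring
  rw [e]

/-- For every `n ≥ 1`, `(2n+1)²·I₂(n+1) = (44n²+1)·I₂(n) + (2n-1)²·I₂(n-1)`. -/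
theorem I₂_recurrence (n : ℕ) (hn : 1 ≤ n) :
    (2 * (n : ℝ) + 1) ^ 2 * I₂ (n + 1)
      = (44 * (n : ℝ) ^ 2 + 1) * I₂ n + (2 * (n : ℝ) - 1) ^ 2 * I₂ (n - 1) := by
  obtain ⟨m, rfl⟩ := Nat.exists_eq_add_of_le' hn
  have h := tsum_eulerTerm_recurrence (by positivity : (0 : ℝ) < m + 1 / 2)
  have e1 : (m : ℝ) + 1 / 2 + 1 = m + 1 + 1 / 2 := by ring
  have e2 : (m : ℝ) + 1 / 2 + 2 = m + 1 + 1 + 1 / 2 := by ring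
  rw [e2, e1] at h
  simp only [I₂_eq, Nat.add_sub_cancel, Nat.cast_add, Nat.cast_one, pow_succ]
  linear_combination 4 * (-1) ^ m * h
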